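/- Let $\omega$ be a non-negative function on primes, $\kappa \ge 1$, $A_1 > 1$, $A_2 > 0$ real constants such that $0 \le \omega(p)/p \le 1 - 1/A_1$ and $\omega(p)\log p / p \le A_2$ for all primes $p$, and such that for all $2 \le w < z$, $\sum_{w \le p < z} \frac{\omega(p)}{p \log p} \le \frac{1}{\log w}\left(\kappa + \frac{A_2}{\log w}\right)$. Let $g(p) = \frac{\omega(p)}{p}(1 - \frac{\omega(p)}{p})^{-1}$. Then for all $2 \le w < z$ and all integers $k \ge 2$: $\sum_{w \le p < z} g(p)^k \le \frac{A_1^k A_2^{k-1}}{(\log w)^{k-1}}\left(\kappa + \frac{A_2}{\log w}\right)$, where the sum is over primes $p$. -/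

import Mathlib

/-- The finite set of primes `p` with `w ≤ p < z`. -/
noncomputable def primesIn (w z : ℝ) : Finset ℕ :=
  (Finset.range ⌈z⌉₊).filter (fun p => p.Prime ∧ w ≤ (p : ℝ) ∧ (p : ℝ) < z)

/-- If `0 ≤ x ≤ 1 - 1 / A`, then passing from `x` to `x / (1 - x)` costs at most a factor `A`. -/
lemma mul_inv_one_sub_le {x A : ℝ} (hA : 0 < A) (hx : 0 ≤ x) (hxA : x ≤ 1 - 1 / A) :
    x * (1 - x)⁻¹ ≤ A * x := by
  have h : (1 - x)⁻¹ ≤ A := inv_le_of_inv_le₀ hA (by rw [← one_div]; linarith)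
  nlinarith

/-- If `x * L ≤ B` with `0 < l ≤ L`, then `x ^ (m + 2)` is controlled by `x / L`. -/
lemma pow_add_two_le_of_mul_le {x L l B : ℝ} (hx : 0 ≤ x) (hl : 0 < l) (hlL : l ≤ L)
    (hxL : x * L ≤ B) (m : ℕ) :
    x ^ (m + 2) ≤ B ^ (m + 1) / l ^ m * (x / L) := by
  have hL : 0 < L := hl.trans_le hlL
  have hB : 0 ≤ B := (mul_nonneg hx hL.le).trans hxL
  calc x ^ (m + 2) = (x * L) ^ (m + 1) / L ^ m * (x / L) := by
        field_simp
        ring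
    _ ≤ B ^ (m + 1) / l ^ m * (x / L) := by gcongr

theorem stmt_7 (ω : ℕ → ℝ) (κ A₁ A₂ : ℝ) (hκ : 1 ≤ κ) (hA₁ : 1 < A₁) (hA₂ : 0 < A₂)
    (hω0 : ∀ p : ℕ, p.Prime → 0 ≤ ω p / p)
    (hΩ₁ : ∀ p : ℕ, p.Prime → ω p / p ≤ 1 - 1 / A₁)
    (hωlog : ∀ p : ℕ, p.Prime → ω p * Real.log p / p ≤ A₂)
    (hsum : ∀ w z : ℝ, 2 ≤ w → w < z →
      ∑ p ∈ primesIn w z, ω p / (p * Real.log p) ≤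
        (1 / Real.log w) * (κ + A₂ / Real.log w))
    (g : ℕ → ℝ) (hg : ∀ p, g p = (ω p / p) * (1 - ω p / p)⁻¹) :
    ∀ (w z : ℝ) (k : ℕ), 2 ≤ w → w < z → 2 ≤ k →
      ∑ p ∈ primesIn w z, g p ^ k ≤
        A₁ ^ k * A₂ ^ (k - 1) / Real.log w ^ (k - 1) * (κ + A₂ / Real.log w) := by
  intro w z k hw hwz hk
  obtain ⟨m, rfl⟩ := Nat.exists_eq_add_of_le' hk
  have hlw : 0 < Real.log w := Real.log_pos (by linarith)
  have hA₁0 : 0 < A₁ := by linarith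
  have hterm : ∀ p ∈ primesIn w z, g p ^ (m + 2) ≤
      A₁ ^ (m + 2) * (A₂ ^ (m + 1) / Real.log w ^ m) * (ω p / (p * Real.log p)) := by
    intro p hp
    obtain ⟨-, hpp, hwp, -⟩ := Finset.mem_filter.mp hp
    have hx := hω0 p hpp
    have hx1 : 0 ≤ 1 - ω p / p := by
      have := hΩ₁ p hpp
      have : 0 < 1 / A₁ := by positivity
      linarith
    have hlog : Real.log w ≤ Real.log p := Real.log_le_log (by linarith) hwp
    calc g p ^ (m + 2) ≤ (A₁ * (ω p / p)) ^ (m + 2) := by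
          rw [hg]
          exact pow_le_pow_left₀ (mul_nonneg hx (inv_nonneg.mpr hx1))
            (mul_inv_one_sub_le hA₁0 hx (hΩ₁ p hpp)) _
      _ = A₁ ^ (m + 2) * (ω p / p) ^ (m + 2) := mul_pow ..
      _ ≤ A₁ ^ (m + 2) * (A₂ ^ (m + 1) / Real.log w ^ m * (ω p / p / Real.log p)) := by
          gcongr
          exact pow_add_two_le_of_mul_le hx hlw hlog
            ((div_mul_eq_mul_div ..).trans_le (hωlog p hpp)) m
      _ = _ := by rw [div_div, mul_assoc]
  calc ∑ p ∈ primesIn w z, g p ^ (m + 2)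
      ≤ A₁ ^ (m + 2) * (A₂ ^ (m + 1) / Real.log w ^ m) *
          ∑ p ∈ primesIn w z, ω p / (p * Real.log p) := by
        rw [Finset.mul_sum]
        exact Finset.sum_le_sum hterm
    _ ≤ A₁ ^ (m + 2) * (A₂ ^ (m + 1) / Real.log w ^ m) *
          ((1 / Real.log w) * (κ + A₂ / Real.log w)) := by
        gcongr
        exact hsum w z hw hwz
    _ = _ := by
        rw [show m + 2 - 1 = m + 1 from rfl]
        field_simp
        ring
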